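/- Let p be a rational number with 1/2 < p < 1 and set p′ := 2 − 1/p. For every n ≥ 1 and all real symmetric n×n matrices X and Y with X ⪰ 0, the following are equivalent: (i) X^p ⪰ Y ⪰ 0; (ii) there exist real symmetric n×n matrices W and Z with W ⪰ 0 such that W^{p′} ⪰ Z ⪰ 0, the block matrix [[X, W],[W, Z]] is positive semidefinite, and W ⪰ Y ⪰ 0. -/

import Mathlib

open Matrix

/-- The power `X^p` of a real symmetric matrix, defined via the spectral
decomposition (powers of the eigenvalues). -/
noncomputable def symPow {n : ℕ} (X : Matrix (Fin n) (Fin n) ℝ) (p : ℝ) :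
    Matrix (Fin n) (Fin n) ℝ :=
  if hX : X.IsHermitian then
    (hX.eigenvectorUnitary : Matrix (Fin n) (Fin n) ℝ) *
      Matrix.diagonal (fun i => hX.eigenvalues i ^ p) *
      (star (hX.eigenvectorUnitary : Matrix (Fin n) (Fin n) ℝ))
  else 0

section

open scoped MatrixOrder ComplexOrder

variable {n : ℕ}

/-- The entrywise inclusion of real matrices into complex matrices. -/
noncomputable def complexify (n : ℕ) :
    Matrix (Fin n) (Fin n) ℝ →⋆ₐ[ℝ] Matrix (Fin n) (Fin n) ℂ :=
  { (Complex.ofRealAm.mapMatrix : Matrix (Fin n) (Fin n) ℝ →ₐ[ℝ] Matrix (Fin n) (Fin n) ℂ) with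
    map_star' := fun A => by ext i j; simp [Matrix.star_eq_conjTranspose] }

lemma complexify_apply (A : Matrix (Fin n) (Fin n) ℝ) (i j : Fin n) :
    complexify n A i j = (A i j : ℂ) := rfl

lemma continuous_complexify : Continuous (complexify n) :=
  Continuous.matrix_map continuous_id Complex.continuous_ofReal

lemma posSemidef_complexify_iff {A : Matrix (Fin n) (Fin n) ℝ} :
    (complexify n A).PosSemidef ↔ A.PosSemidef := by
  constructor
  · intro h
    refine .of_dotProduct_mulVec_nonneg ?_ fun x => ?_
    · ext i j
      have := h.1.apply i j
      simpa [complexify_apply] using this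
    · have := h.dotProduct_mulVec_nonneg (fun i => (x i : ℂ))
      simp only [dotProduct, mulVec, complexify_apply, Pi.star_apply, RCLike.star_def,
        Complex.conj_ofReal] at this
      simp only [dotProduct, mulVec, Pi.star_apply, star_trivial]
      exact_mod_cast this
  · intro h
    obtain ⟨B, rfl⟩ := CStarAlgebra.nonneg_iff_eq_star_mul_self.mp h.nonneg
    rw [map_mul, map_star]
    exact posSemidef_conjTranspose_mul_self _

lemma symPow_eq_cfc {X : Matrix (Fin n) (Fin n) ℝ} (hX : X.IsHermitian) (p : ℝ) :
    symPow X p = cfc (fun x : ℝ => x ^ p) X := by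
  rw [symPow, dif_pos hX, hX.cfc_eq]
  rfl

lemma continuousOn_spectrum (f : ℝ → ℝ) (X : Matrix (Fin n) (Fin n) ℝ) :
    ContinuousOn f (spectrum ℝ X) :=
  X.finite_real_spectrum.continuousOn f

lemma symPow_isHermitian (X : Matrix (Fin n) (Fin n) ℝ) (p : ℝ) :
    (symPow X p).IsHermitian := by
  by_cases hX : X.IsHermitian
  · rw [symPow_eq_cfc hX]
    exact cfc_predicate _ X
  · rw [symPow, dif_neg hX]
    exact isHermitian_zero

lemma symPow_posSemidef {X : Matrix (Fin n) (Fin n) ℝ} (hX : X.PosSemidef) (p : ℝ) :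
    (symPow X p).PosSemidef := by
  rw [symPow_eq_cfc hX.1, ← nonneg_iff_posSemidef]
  exact cfc_nonneg fun x hx => Real.rpow_nonneg (spectrum_nonneg_of_nonneg hX.nonneg hx) p

lemma symPow_one {X : Matrix (Fin n) (Fin n) ℝ} (hX : X.IsHermitian) : symPow X 1 = X := by
  rw [symPow_eq_cfc hX]
  simpa using cfc_id' ℝ X hX.isSelfAdjoint

lemma symPow_mul_symPow {X : Matrix (Fin n) (Fin n) ℝ} (hX : X.PosSemidef) {a b : ℝ}
    (ha : 0 < a) (hb : 0 < b) : symPow X a * symPow X b = symPow X (a + b) := by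
  simp only [symPow_eq_cfc hX.1]
  rw [← cfc_mul _ _ X (continuousOn_spectrum _ X) (continuousOn_spectrum _ X)]
  refine cfc_congr fun x hx => ?_
  exact (Real.rpow_add_of_nonneg (spectrum_nonneg_of_nonneg hX.nonneg hx) ha.le hb.le).symm

lemma symPow_symPow {X : Matrix (Fin n) (Fin n) ℝ} (hX : X.PosSemidef) (a b : ℝ) :
    symPow (symPow X a) b = symPow X (a * b) := by
  rw [symPow_eq_cfc (symPow_isHermitian X a), symPow_eq_cfc hX.1, symPow_eq_cfc hX.1,
    ← cfc_comp' (fun x : ℝ => x ^ b) (fun x : ℝ => x ^ a) X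
      ((X.finite_real_spectrum.image _).continuousOn _) (continuousOn_spectrum _ X)
      hX.1.isSelfAdjoint]
  refine cfc_congr fun x hx => ?_
  exact (Real.rpow_mul (spectrum_nonneg_of_nonneg hX.nonneg hx) a b).symm

open scoped Matrix.Norms.L2Operator in
lemma complexify_symPow {X : Matrix (Fin n) (Fin n) ℝ} (hX : X.PosSemidef) (p : ℝ) :
    complexify n (symPow X p) = complexify n X ^ p := by
  have hX' : 0 ≤ complexify n X := (posSemidef_complexify_iff.mpr hX).nonneg
  rw [symPow_eq_cfc hX.1, CFC.rpow_eq_cfc_real hX']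
  exact StarAlgHomClass.map_cfc (S := ℝ) (complexify n) _ X (continuousOn_spectrum _ X)
    continuous_complexify hX.1.isSelfAdjoint hX'.isSelfAdjoint

open scoped Matrix.Norms.L2Operator in
/-- **Löwner–Heinz inequality** for real symmetric matrices. -/
lemma symPow_sub_symPow_posSemidef {A B : Matrix (Fin n) (Fin n) ℝ} (hA : A.PosSemidef)
    (hAB : (B - A).PosSemidef) {p : ℝ} (hp : p ∈ Set.Icc 0 1) :
    (symPow B p - symPow A p).PosSemidef := by
  have hB : B.PosSemidef := by simpa using hA.add hAB
  rw [← posSemidef_complexify_iff, map_sub, complexify_symPow hA, complexify_symPow hB]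
  refine Matrix.le_iff.mp (CFC.rpow_le_rpow hp ?_)
  rw [Matrix.le_iff, ← map_sub]
  exact posSemidef_complexify_iff.mpr hAB

/-- A Schur-complement type bound that needs no invertibility. -/
lemma sub_posSemidef_of_fromBlocks {X W Z S : Matrix (Fin n) (Fin n) ℝ} (hS : S.IsHermitian)
    (h : (fromBlocks X W W Z).PosSemidef) :
    (X - W * S - S * W + S * Z * S).PosSemidef := by
  have := h.conjTranspose_mul_mul_same (fromRows (1 : Matrix (Fin n) (Fin n) ℝ) (-S))
  rw [conjTranspose_fromRows_eq_fromCols_conjTranspose, fromCols_mul_fromBlocks,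
    fromCols_mul_fromRows, conjTranspose_neg, hS.eq, conjTranspose_one] at this
  convert this using 1
  noncomm_ring

/-- The block matrix `[[X, X ^ p], [X ^ p, X ^ (2 * p - 1)]]` is positive semidefinite. -/
lemma fromBlocks_symPow_posSemidef {X : Matrix (Fin n) (Fin n) ℝ} (hX : X.PosSemidef) {p : ℝ}
    (hp : 1 / 2 < p) :
    (fromBlocks X (symPow X p) (symPow X p) (symPow X (2 * p - 1))).PosSemidef := by
  have h := posSemidef_conjTranspose_mul_self
    (fromCols (symPow X (1 / 2)) (symPow X (p - 1 / 2)))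
  have hp' : 0 < p - 1 / 2 := by linarith
  rw [conjTranspose_fromCols_eq_fromRows_conjTranspose, fromRows_mul_fromCols,
    (symPow_isHermitian X _).eq, (symPow_isHermitian X _).eq,
    symPow_mul_symPow hX (by norm_num) (by norm_num), symPow_mul_symPow hX (by norm_num) hp',
    symPow_mul_symPow hX hp' (by norm_num), symPow_mul_symPow hX hp' hp'] at h
  convert h using 2
  · norm_num [symPow_one hX.1]
  all_goals ring_nf

end

/-- Let `p` be rational with `1/2 < p < 1` and `p' := 2 - 1/p`.  For every
`n ≥ 1` and real symmetric `n × n` matrices `X ⪰ 0` and `Y`: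
`X^p ⪰ Y ⪰ 0` iff there are real symmetric `W ⪰ 0` and `Z` with
`W^{p'} ⪰ Z ⪰ 0`, `[[X, W], [W, Z]] ⪰ 0` and `W ⪰ Y ⪰ 0`. -/
theorem power_hypograph_step_large (p : ℚ) (hp1 : 1 / 2 < p) (hp2 : p < 1)
    (n : ℕ) (hn : 1 ≤ n)
    (X Y : Matrix (Fin n) (Fin n) ℝ) (hX : X.PosSemidef) (hY : Y.IsHermitian) :
    ((symPow X (p : ℝ) - Y).PosSemidef ∧ Y.PosSemidef)
      ↔
    (∃ W Z : Matrix (Fin n) (Fin n) ℝ, W.IsHermitian ∧ Z.IsHermitian ∧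
      W.PosSemidef ∧
      (symPow W ((2 - 1 / p : ℚ) : ℝ) - Z).PosSemidef ∧ Z.PosSemidef ∧
      (Matrix.fromBlocks X W W Z).PosSemidef ∧
      (W - Y).PosSemidef ∧ Y.PosSemidef) := by

  have hp1' : (1 / 2 : ℝ) < p := by
    have : ((1 / 2 : ℚ) : ℝ) < p := Rat.cast_lt.mpr hp1
    simpa using this
  have hp2' : (p : ℝ) < 1 := by exact_mod_cast hp2
  have hp0 : (0 : ℝ) < p := by linarith
  push_cast
  constructor
  · rintro ⟨h, hY0⟩
    have hexp : (p : ℝ) * (2 - 1 / p) = 2 * p - 1 := by field_simp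
    refine ⟨symPow X p, symPow X (2 * p - 1), symPow_isHermitian X _, symPow_isHermitian X _,
      symPow_posSemidef hX _, ?_, symPow_posSemidef hX _, fromBlocks_symPow_posSemidef hX hp1',
      h, hY0⟩
    rw [symPow_symPow hX, hexp, sub_self]
    exact PosSemidef.zero
  · rintro ⟨W, Z, hW, -, hW0, hZW, -, hblock, hWY, hY0⟩
    refine ⟨?_, hY0⟩
    have hinv : 1 < 1 / (p : ℝ) := by rw [lt_div_iff₀ hp0]; linarith
    have hinv2 : 1 / (p : ℝ) < 2 := by rw [div_lt_iff₀ hp0]; linarith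
    have hq : 0 < 1 / (p : ℝ) - 1 := by linarith
    have hq' : 0 < 2 - 1 / (p : ℝ) := by linarith
    set S := symPow W (1 / (p : ℝ) - 1)
    have hS : S.IsHermitian := symPow_isHermitian W _
    have hWS : W * S = symPow W (1 / p) := by
      conv_lhs => rw [← symPow_one hW]
      rw [symPow_mul_symPow hW0 one_pos hq]
      ring_nf
    have hSW : S * W = symPow W (1 / p) := by
      conv_lhs => rw [← symPow_one hW]
      rw [symPow_mul_symPow hW0 hq one_pos]
      ring_nf
    have hSZS : S * symPow W (2 - 1 / p) * S = symPow W (1 / p) := by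
      rw [symPow_mul_symPow hW0 hq hq', symPow_mul_symPow hW0 (by linarith) hq]
      ring_nf
    have hZ := hZW.conjTranspose_mul_mul_same S
    rw [hS.eq, mul_sub, sub_mul, hSZS] at hZ
    have hXW : (X - symPow W (1 / p)).PosSemidef := by
      have := (sub_posSemidef_of_fromBlocks hS hblock).add hZ
      rw [hWS, hSW] at this
      convert this using 1
      abel
    have hXp := symPow_sub_symPow_posSemidef (symPow_posSemidef hW0 _) hXW
      (Set.mem_Icc.mpr ⟨hp0.le, hp2'.le⟩)
    rw [symPow_symPow hW0, one_div_mul_cancel hp0.ne', symPow_one hW] at hXp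
    simpa using hXp.add hWY
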